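/- arXiv:1305.0746 — 2 statements merged into one kernel-verified Lean document; each statement's English description precedes it below -/
import Mathlib

section
/- Let M be a finitely generated projective module over a commutative unital ring k, let x ∈ Λ_l(M) and ξ ∈ Λ_l(M*). Then e(x,ξ)* = e(ξ,x); that is, for every φ ∈ M* and m ∈ M one has φ(e(x,ξ)(m)) = (e(ξ,x)(φ))(m). -/
open ExteriorAlgebra

/-- The algebra homomorphism `Δ : Λ(M*) → End(Λ(M))` extending the contraction
`φ ↦ Δ_φ`, so that `Δ(ξ)(x) = ξ·x`. -/
noncomputable def extDelta (R : Type*) [CommRing R] (M : Type*) [AddCommGroup M] [Module R M] :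
    ExteriorAlgebra R (Module.Dual R M) →ₐ[R] Module.End R (ExteriorAlgebra R M) :=
  ExteriorAlgebra.lift R ⟨CliffordAlgebra.contractLeft (Q := (0 : QuadraticForm R M)),
    fun d => LinearMap.ext fun x => CliffordAlgebra.contractLeft_contractLeft d x⟩

/-- The algebra homomorphism `Δ' : Λ(M) → End(Λ(M*))` obtained from contraction via
the canonical map `M → M**`, so that `Δ'(x)(ξ) = x·ξ`. -/
noncomputable def extDelta' (R : Type*) [CommRing R] (M : Type*) [AddCommGroup M] [Module R M] :
    ExteriorAlgebra R M →ₐ[R] Module.End R (ExteriorAlgebra R (Module.Dual R M)) :=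
  ExteriorAlgebra.lift R
    ⟨(CliffordAlgebra.contractLeft
        (Q := (0 : QuadraticForm R (Module.Dual R M)))).comp (Module.Dual.eval R M),
      fun _ => LinearMap.ext fun ξ => CliffordAlgebra.contractLeft_contractLeft _ ξ⟩

/-- The endomorphism `e(x,ξ)` of `M`, `m ↦ (m·ξ)·x`, where the result is viewed in
`M` via the (partial) inverse `ιInv` of `ι : M → Λ(M)`; for `x ∈ Λ_l(M)` and
`ξ ∈ Λ_l(M*)` the element `(m·ξ)·x` indeed lies in `Λ₁(M) = M`. -/
noncomputable def extE (R : Type*) [CommRing R] (M : Type*) [AddCommGroup M] [Module R M]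
    (x : ExteriorAlgebra R M) (ξ : ExteriorAlgebra R (Module.Dual R M)) :
    Module.End R M :=
  ιInv ∘ₗ LinearMap.applyₗ x ∘ₗ (extDelta R M).toLinearMap ∘ₗ
    LinearMap.applyₗ ξ ∘ₗ (extDelta' R M).toLinearMap ∘ₗ ι R

/-- The endomorphism `e(ξ,x)` of `M*`, `φ ↦ (φ·x)·ξ`, where the result is viewed in
`M*` via the (partial) inverse `ιInv` of `ι : M* → Λ(M*)`. -/
noncomputable def extE' (R : Type*) [CommRing R] (M : Type*) [AddCommGroup M] [Module R M]
    (ξ : ExteriorAlgebra R (Module.Dual R M)) (x : ExteriorAlgebra R M) :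
    Module.End R (Module.Dual R M) :=
  ιInv ∘ₗ LinearMap.applyₗ ξ ∘ₗ (extDelta' R M).toLinearMap ∘ₗ
    LinearMap.applyₗ x ∘ₗ (extDelta R M).toLinearMap ∘ₗ ι R

open CliffordAlgebra (contractLeft involute)

section Contraction

variable {R M : Type*} [CommRing R] [AddCommGroup M] [Module R M]

/-- Contraction of a product whose last factor is a vector. -/
theorem contractLeft_mul_ι {Q : QuadraticForm R M} (d : Module.Dual R M)
    (b : CliffordAlgebra Q) (m : M) :
    contractLeft d (b * CliffordAlgebra.ι Q m) =
      contractLeft d b * CliffordAlgebra.ι Q m + d m • involute b := by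
  induction b using CliffordAlgebra.left_induction with
  | algebraMap r =>
    simp [Algebra.algebraMap_eq_smul_one, smul_comm r]
  | add x y hx hy => simp only [add_mul, map_add, hx, hy, smul_add]; abel
  | ι_mul x n hx =>
    rw [mul_assoc, CliffordAlgebra.contractLeft_ι_mul, CliffordAlgebra.contractLeft_ι_mul, hx,
      map_mul, CliffordAlgebra.involute_ι, mul_add, sub_mul, smul_mul_assoc, mul_smul_comm,
      neg_mul, smul_neg, mul_assoc]
    abel

theorem contractLeft_involute {Q : QuadraticForm R M} (d : Module.Dual R M)
    (b : CliffordAlgebra Q) : contractLeft d (involute b) = -involute (contractLeft d b) := by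
  induction b using CliffordAlgebra.left_induction with
  | algebraMap r => simp
  | add x y hx hy => simp only [map_add, hx, hy, neg_add]
  | ι_mul x n hx =>
    simp only [map_mul, CliffordAlgebra.involute_ι, neg_mul, map_neg,
      CliffordAlgebra.contractLeft_ι_mul, hx, map_sub, map_smul]
    simp

namespace ExteriorAlgebra

theorem mul_ι_eq_ι_mul_involute (b : ExteriorAlgebra R M) (m : M) :
    b * ι R m = ι R m * involute b := by
  induction b using CliffordAlgebra.left_induction with
  | algebraMap r => simp [Algebra.commutes]
  | add x y hx hy => simp only [add_mul, map_add, hx, hy, mul_add]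
  | ι_mul x n hx =>
    have h : ι R n * ι R m = -(ι R m * ι R n) := eq_neg_of_add_eq_zero_left (ι_add_mul_swap n m)
    change ι R n * x * ι R m = ι R m * involute (ι R n * x)
    rw [mul_assoc, hx, ← mul_assoc, h, map_mul, CliffordAlgebra.involute_ι, neg_mul, neg_mul,
      mul_neg, mul_assoc]

theorem algebraMapInv_ι (m : M) : algebraMapInv (ι R m) = 0 := by
  simp [algebraMapInv]

theorem algebraMapInv_involute (b : ExteriorAlgebra R M) :
    algebraMapInv (involute b) = algebraMapInv b := by
  induction b using CliffordAlgebra.left_induction with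
  | algebraMap r => simp
  | add x y hx hy => simp only [map_add, hx, hy]
  | ι_mul x n hx =>
    change algebraMapInv (involute (ι R n * x)) = algebraMapInv (ι R n * x)
    rw [map_mul, CliffordAlgebra.involute_ι, map_mul, map_mul, map_neg]
    erw [algebraMapInv_ι]
    simp

theorem fst_toTrivSqZeroExt [Module Rᵐᵒᵖ M] [IsCentralScalar R M] (b : ExteriorAlgebra R M) :
    (toTrivSqZeroExt b).fst = algebraMapInv b := by
  suffices (TrivSqZeroExt.fstHom R R M).comp toTrivSqZeroExt = algebraMapInv from
    DFunLike.congr_fun this b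
  ext m
  simp [algebraMapInv_ι]

theorem ιInv_ι_mul (m : M) (b : ExteriorAlgebra R M) :
    ιInv (ι R m * b) = algebraMapInv b • m := by
  let _ : Module Rᵐᵒᵖ M := Module.compHom _ ((RingHom.id R).fromOpposite mul_comm)
  have _ : IsCentralScalar R M := ⟨fun r m => rfl⟩
  change (toTrivSqZeroExt (ι R m * b)).snd = _
  simp [fst_toTrivSqZeroExt]

theorem ιInv_algebraMap (r : R) : ιInv (algebraMap R (ExteriorAlgebra R M) r) = 0 := by
  let _ : Module Rᵐᵒᵖ M := Module.compHom _ ((RingHom.id R).fromOpposite mul_comm)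
  have _ : IsCentralScalar R M := ⟨fun r m => rfl⟩
  change (toTrivSqZeroExt (algebraMap R (ExteriorAlgebra R M) r)).snd = _
  rw [AlgHom.commutes]
  rfl

/-- A linear form on the degree one part is the degree zero part of the contraction. -/
theorem apply_ιInv (φ : Module.Dual R M) (b : ExteriorAlgebra R M) :
    φ (ιInv b) = algebraMapInv (contractLeft (Q := (0 : QuadraticForm R M)) φ b) := by
  induction b using CliffordAlgebra.left_induction with
  | algebraMap r =>
    rw [CliffordAlgebra.contractLeft_algebraMap]
    exact (congrArg φ (ιInv_algebraMap r)).trans (by simp)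
  | add x y hx hy => simp only [map_add, hx, hy]
  | ι_mul x n hx =>
    rw [CliffordAlgebra.contractLeft_ι_mul]
    refine (congrArg φ (ιInv_ι_mul n x)).trans ?_
    rw [map_sub, map_mul, map_smul, map_smul]
    erw [algebraMapInv_ι]
    simp [mul_comm]

end ExteriorAlgebra

theorem extDelta_ι (φ : Module.Dual R M) (x : ExteriorAlgebra R M) :
    extDelta R M (ι R φ) x = contractLeft (Q := (0 : QuadraticForm R M)) φ x := by
  simp [extDelta]

theorem extDelta'_ι (m : M) (ξ : ExteriorAlgebra R (Module.Dual R M)) :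
    extDelta' R M (ι R m) ξ =
      contractLeft (Q := (0 : QuadraticForm R (Module.Dual R M))) (Module.Dual.eval R M m) ξ := by
  simp [extDelta']

theorem extDelta'_one (x : ExteriorAlgebra R M) :
    extDelta' R M x 1 = algebraMap R _ (algebraMapInv x) := by
  induction x using CliffordAlgebra.left_induction with
  | algebraMap r =>
    rw [AlgHom.commutes, AlgHom.commutes]
    simp [Algebra.algebraMap_eq_smul_one]
  | add x y hx hy => simp only [map_add, LinearMap.add_apply, hx, hy]
  | ι_mul x n hx =>
    change extDelta' R M (ι R n * x) 1 = algebraMap R _ (algebraMapInv (ι R n * x))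
    rw [map_mul, Module.End.mul_apply, hx, extDelta'_ι, map_mul, algebraMapInv_ι,
      CliffordAlgebra.contractLeft_algebraMap, zero_mul, map_zero]

theorem extDelta'_involute (x : ExteriorAlgebra R M) (ξ : ExteriorAlgebra R (Module.Dual R M)) :
    extDelta' R M (involute x) (involute ξ) = involute (extDelta' R M x ξ) := by
  induction x using CliffordAlgebra.left_induction with
  | algebraMap r =>
    rw [AlgHom.commutes, AlgHom.commutes]
    simp [Module.algebraMap_end_apply]
  | add x y hx hy => simp only [map_add, LinearMap.add_apply, hx, hy]
  | ι_mul x n hx =>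
    change extDelta' R M (involute (ι R n * x)) _ = involute (extDelta' R M (ι R n * x) ξ)
    rw [map_mul, CliffordAlgebra.involute_ι, map_mul, map_mul, map_neg, Module.End.mul_apply,
      Module.End.mul_apply, hx, LinearMap.neg_apply]
    erw [extDelta'_ι, extDelta'_ι]
    rw [contractLeft_involute, neg_neg]

theorem algebraMapInv_extDelta'_involute (x : ExteriorAlgebra R M)
    (ξ : ExteriorAlgebra R (Module.Dual R M)) :
    algebraMapInv (extDelta' R M (involute x) ξ) = algebraMapInv (extDelta' R M x (involute ξ)) := by
  rw [← algebraMapInv_involute (extDelta' R M x (involute ξ)), ← extDelta'_involute,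
    CliffordAlgebra.involute_involute]

/-- Right multiplication by `φ` is adjoint to contraction by `φ`. -/
theorem algebraMapInv_extDelta'_mul_ι (x : ExteriorAlgebra R M)
    (ξ : ExteriorAlgebra R (Module.Dual R M)) (φ : Module.Dual R M) :
    algebraMapInv (extDelta' R M x (ξ * ι R φ)) =
      algebraMapInv (extDelta' R M (contractLeft (Q := (0 : QuadraticForm R M)) φ x) ξ) := by
  induction x using CliffordAlgebra.right_induction generalizing ξ with
  | algebraMap r =>
    rw [AlgHom.commutes, CliffordAlgebra.contractLeft_algebraMap, Module.algebraMap_end_apply,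
      map_smul, map_mul, algebraMapInv_ι]
    simp
  | add x y hx hy => simp only [map_add, LinearMap.add_apply, hx, hy]
  | mul_ι m y hy =>
    rw [contractLeft_mul_ι, map_add, map_smul]
    change algebraMapInv (extDelta' R M (y * ι R m) _) =
      algebraMapInv ((extDelta' R M (_ * ι R m) + _) ξ)
    rw [map_mul (extDelta' R M), map_mul (extDelta' R M), Module.End.mul_apply,
      LinearMap.add_apply, Module.End.mul_apply,
      extDelta'_ι, extDelta'_ι, LinearMap.smul_apply, map_add, map_smul, ← hy,
      algebraMapInv_extDelta'_involute, ← map_smul, ← map_smul, ← map_add, ← map_add]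
    exact congrArg _ (congrArg _ (contractLeft_mul_ι _ _ _))

/-- The pairings of `Λ(M*)` and `Λ(M)` defined by the two contraction actions agree. -/
theorem algebraMapInv_extDelta (x : ExteriorAlgebra R M)
    (ξ : ExteriorAlgebra R (Module.Dual R M)) :
    algebraMapInv (extDelta R M ξ x) = algebraMapInv (extDelta' R M x ξ) := by
  induction ξ using CliffordAlgebra.right_induction generalizing x with
  | algebraMap r =>
    rw [AlgHom.commutes, Module.algebraMap_end_apply, Algebra.algebraMap_eq_smul_one, map_smul,
      map_smul, map_smul]
    erw [extDelta'_one]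
    rw [algebraMap_leftInverse]
  | add x y hx hy => simp only [map_add, LinearMap.add_apply, hx, hy]
  | mul_ι φ η hη =>
    change algebraMapInv (extDelta R M (η * ι R φ) x) =
      algebraMapInv (extDelta' R M x (η * ι R φ))
    rw [algebraMapInv_extDelta'_mul_ι, ← hη, map_mul, Module.End.mul_apply, extDelta_ι]

end Contraction

/-- For a finitely generated projective module `M`, `x ∈ Λ_l(M)` and
`ξ ∈ Λ_l(M*)`, one has `e(x,ξ)* = e(ξ,x)`: for every `φ ∈ M*` and `m ∈ M`,
`φ(e(x,ξ)(m)) = (e(ξ,x)(φ))(m)`. -/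
theorem extE_adjoint
    (R : Type*) [CommRing R] (M : Type*) [AddCommGroup M] [Module R M]
    [Module.Finite R M] [Module.Projective R M] (l : ℕ)
    (x : ExteriorAlgebra R M) (hx : x ∈ ⋀[R]^l M)
    (ξ : ExteriorAlgebra R (Module.Dual R M)) (hξ : ξ ∈ ⋀[R]^l (Module.Dual R M))
    (φ : Module.Dual R M) (m : M) :
    φ (extE R M x ξ m) = extE' R M ξ x φ m := by
  change φ (ιInv (extDelta R M (extDelta' R M (ι R m) ξ) x)) =
    Module.Dual.eval R M m (ιInv (extDelta' R M (extDelta R M (ι R φ) x) ξ))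
  rw [apply_ιInv, apply_ιInv, ← extDelta_ι, ← extDelta'_ι, ← Module.End.mul_apply,
    ← Module.End.mul_apply, ← map_mul, ← map_mul]
  set ζ := extDelta' R M (ι R m) ξ with hζ
  set y := extDelta R M (ι R φ) x with hy
  have h₁ : ι R φ * ζ = involute ζ * ι R φ := by
    rw [mul_ι_eq_ι_mul_involute, CliffordAlgebra.involute_involute]
  have h₂ : ι R m * y = involute y * ι R m := by
    rw [mul_ι_eq_ι_mul_involute, CliffordAlgebra.involute_involute]
  rw [h₁, h₂, map_mul, map_mul, Module.End.mul_apply, Module.End.mul_apply, ← hy, ← hζ,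
    algebraMapInv_extDelta, algebraMapInv_extDelta'_involute]
end

section
/- Let M be a finitely generated projective module of rank n over a commutative unital ring k, let x ∈ Λ(M), u ∈ Λ_n(M), and μ ∈ Λ_n(M*). Then (x·μ)·u = (μ·u)·x in Λ(M), where μ·u ∈ k is the degree-0 scalar Δ(μ)(u); that is, Δ(Δ'(x)(μ))(u) = c·x where Δ(μ)(u) = c·1. -/
open ExteriorAlgebra

/-- An alternating map in `m` variables vanishes on families lying in the span of fewer than `m`
vectors. -/
theorem AlternatingMap.eq_zero_of_mem_span_range {R M N : Type*} [CommRing R] [AddCommGroup M]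
    [Module R M] [AddCommGroup N] [Module R N] {m n : ℕ} (hnm : n < m)
    (f : M [⋀^Fin m]→ₗ[R] N) (v : Fin n → M) (w : Fin m → M)
    (hw : ∀ i, w i ∈ Submodule.span R (Set.range v)) : f w = 0 := by
  have hzero : f.compLinearMap (Fintype.linearCombination R v) = 0 :=
    (Pi.basisFun R (Fin n)).ext_alternating fun σ hσ => by
      have := Fintype.card_le_of_injective σ hσ
      simp only [Fintype.card_fin] at this
      omega
  simp only [← Fintype.range_linearCombination R v, LinearMap.mem_range] at hw
  choose a ha using hw
  simpa [ha] using DFunLike.congr_fun hzero a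

/-- If a localization of `M` is spanned by `n` elements, then `M` contains `n` elements whose span
contains a multiple of every element of `M` by an element of the localizing submonoid. -/
theorem LocalizedModule.exists_smul_mem_span_range {R M : Type*} [CommRing R] [AddCommGroup M]
    [Module R M] (S : Submonoid R) {ι : Type*} (b : ι → LocalizedModule S M)
    (hb : Submodule.span (Localization S) (Set.range b) = ⊤) :
    ∃ v : ι → M, ∀ m : M, ∃ s : S, s • m ∈ Submodule.span R (Set.range v) := by
  have hsurj := IsLocalizedModule.mk'_surjective S (LocalizedModule.mkLinearMap S M)
  choose v hv using fun i => hsurj (b i)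
  refine ⟨fun i => (v i).1, fun m => ?_⟩
  have htop : (Submodule.span R (Set.range fun i => (v i).1)).localized S = ⊤ := by
    rw [eq_top_iff, ← hb, Submodule.span_le]
    rintro _ ⟨i, rfl⟩
    exact ⟨(v i).1, Submodule.subset_span ⟨i, rfl⟩, (v i).2, hv i⟩
  obtain ⟨m', hm', s, h⟩ : LocalizedModule.mkLinearMap S M m ∈
      (Submodule.span R (Set.range fun i => (v i).1)).localized S := htop ▸ Submodule.mem_top
  rw [IsLocalizedModule.mk'_eq_iff, Submonoid.smul_def, ← map_smul,
    IsLocalizedModule.eq_iff_exists S] at h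
  obtain ⟨t, ht⟩ := h
  refine ⟨t * s, ?_⟩
  rw [mul_smul, Submonoid.smul_def s m, ← ht]
  exact Submodule.smul_mem _ (t : R) hm'

/-- An alternating map in `n + 1` variables vanishes on a module of rank `n`. -/
theorem AlternatingMap.eq_zero_of_finrank_localizedModule {R M N : Type*} [CommRing R]
    [AddCommGroup M] [Module R M] [Module.Finite R M] [AddCommGroup N] [Module R N] {n : ℕ}
    (hrank : ∀ (p : Ideal R) [p.IsPrime],
      Module.Free (Localization.AtPrime p) (LocalizedModule p.primeCompl M) ∧
      Module.finrank (Localization.AtPrime p) (LocalizedModule p.primeCompl M) = n)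
    (f : M [⋀^Fin (n + 1)]→ₗ[R] N) : f = 0 := by
  ext w
  by_contra hne
  have hann : LinearMap.ker (LinearMap.toSpanSingleton R N (f w)) ≠ ⊤ := fun h => hne <| by
    simpa using (Ideal.eq_top_iff_one _).1 h
  obtain ⟨p, hp, hle⟩ := Ideal.exists_le_maximal _ hann
  obtain ⟨hfree, hfin⟩ := hrank p
  let b := Module.finBasisOfFinrankEq (Localization.AtPrime p)
    (LocalizedModule p.primeCompl M) hfin
  obtain ⟨v, hv⟩ := LocalizedModule.exists_smul_mem_span_range p.primeCompl b b.span_eq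
  choose s hs using fun i => hv (w i)
  have hzero := f.eq_zero_of_mem_span_range n.lt_succ_self v (fun i => (s i : R) • w i) hs
  rw [f.map_smul_univ] at hzero
  refine (∏ i, s i).2 (hle ?_)
  simpa using hzero

/-- Multiplication by a vector kills the top exterior power of a module of rank `n`. -/
theorem ExteriorAlgebra.ι_mul_eq_zero_of_finrank_localizedModule {R M : Type*} [CommRing R]
    [AddCommGroup M] [Module R M] [Module.Finite R M] {n : ℕ}
    (hrank : ∀ (p : Ideal R) [p.IsPrime],
      Module.Free (Localization.AtPrime p) (LocalizedModule p.primeCompl M) ∧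
      Module.finrank (Localization.AtPrime p) (LocalizedModule p.primeCompl M) = n)
    (m : M) {u : ExteriorAlgebra R M} (hu : u ∈ ⋀[R]^n M) : ι R m * u = 0 := by
  rw [← ιMulti_span_fixedDegree] at hu
  induction hu using Submodule.span_induction with
  | mem _ h =>
    obtain ⟨w, rfl⟩ := h
    have := DFunLike.congr_fun
      (AlternatingMap.eq_zero_of_finrank_localizedModule hrank (ιMulti R (n + 1)))
      (Matrix.vecCons m w)
    simpa [ιMulti_succ_apply] using this
  | zero => simp
  | add _ _ _ _ hx hy => rw [mul_add, hx, hy, add_zero]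
  | smul r _ _ h => rw [mul_smul_comm, h, smul_zero]

section Contraction

variable {R M : Type*} [CommRing R] [AddCommGroup M] [Module R M]

theorem extDelta_ι_ι_mul (φ : Module.Dual R M) (m : M) (y : ExteriorAlgebra R M) :
    extDelta R M (ι R φ) (ι R m * y) = φ m • y - ι R m * extDelta R M (ι R φ) y := by
  simp only [extDelta, lift_ι_apply]
  exact CliffordAlgebra.contractLeft_ι_mul φ m y

theorem extDelta'_ι_algebraMap (m : M) (r : R) :
    extDelta' R M (ι R m) (algebraMap R _ r) = 0 := by
  simp only [extDelta', lift_ι_apply]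
  exact CliffordAlgebra.contractLeft_algebraMap (Q := 0) _ r

theorem extDelta'_ι_ι_mul (m : M) (φ : Module.Dual R M)
    (ξ : ExteriorAlgebra R (Module.Dual R M)) :
    extDelta' R M (ι R m) (ι R φ * ξ) = φ m • ξ - ι R φ * extDelta' R M (ι R m) ξ := by
  simp only [extDelta', lift_ι_apply]
  exact CliffordAlgebra.contractLeft_ι_mul _ φ ξ

/-- Contraction by `m · ξ` is the graded commutator of multiplication by `m` with contraction
by `ξ`. -/
theorem extDelta_extDelta'_ι (m : M) (ξ : ExteriorAlgebra R (Module.Dual R M))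
    (y : ExteriorAlgebra R M) :
    extDelta R M (extDelta' R M (ι R m) ξ) y =
      ι R m * extDelta R M ξ y -
        extDelta R M (CliffordAlgebra.involute ξ) (ι R m * y) := by
  induction ξ using CliffordAlgebra.left_induction generalizing y with
  | algebraMap r =>
    have h := extDelta'_ι_algebraMap m r
    simp only [ExteriorAlgebra] at h ⊢
    rw [h]
    simp
  | add a b ha hb =>
    simp only [map_add, LinearMap.add_apply, ha, hb, mul_add]
    abel
  | ι_mul η φ h =>
    change extDelta R M (extDelta' R M (ι R m) (ι R φ * η)) y =
      ι R m * extDelta R M (ι R φ * η) y -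
        extDelta R M (CliffordAlgebra.involute (ι R φ * η)) (ι R m * y)
    have hinv : CliffordAlgebra.involute (ι R φ * η) =
        -(ι R φ * CliffordAlgebra.involute η) := by
      rw [map_mul, ← neg_mul]
      exact congrArg (· * _) (CliffordAlgebra.involute_ι φ)
    rw [extDelta'_ι_ι_mul, hinv]
    simp only [map_sub, map_neg, map_mul, map_smul, LinearMap.sub_apply, LinearMap.neg_apply,
      LinearMap.smul_apply, Module.End.mul_apply, h, extDelta_ι_ι_mul]
    abel

end Contraction

/-- For a finitely generated projective module `M` of rank `n`,
`x ∈ Λ(M)`, `u ∈ Λ_n(M)` and `μ ∈ Λ_n(M*)`, one has `(x·μ)·u = (μ·u)·x` in `Λ(M)`,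
where `μ·u ∈ k` is the degree-0 scalar `Δ(μ)(u)`. -/
theorem contraction_top_identity
    (R : Type*) [CommRing R] (M : Type*) [AddCommGroup M] [Module R M]
    [Module.Finite R M] [Module.Projective R M] (n : ℕ)
    (hrank : ∀ (p : Ideal R) [p.IsPrime],
      Module.Free (Localization.AtPrime p) (LocalizedModule p.primeCompl M) ∧
      Module.finrank (Localization.AtPrime p) (LocalizedModule p.primeCompl M) = n)
    (x : ExteriorAlgebra R M)
    (u : ExteriorAlgebra R M) (hu : u ∈ ⋀[R]^n M)
    (μ : ExteriorAlgebra R (Module.Dual R M)) (hμ : μ ∈ ⋀[R]^n (Module.Dual R M))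
    (c : R) (hc : extDelta R M μ u = algebraMap R (ExteriorAlgebra R M) c) :
    extDelta R M (extDelta' R M x μ) u = c • x := by
  have key : ∀ ξ, extDelta R M (extDelta' R M x ξ) u = x * extDelta R M ξ u := by
    induction x using ExteriorAlgebra.induction with
    | algebraMap r => intro ξ; simp [Algebra.smul_def]
    | ι m =>
      intro ξ
      rw [extDelta_extDelta'_ι, ι_mul_eq_zero_of_finrank_localizedModule hrank m hu, map_zero,
        sub_zero]
    | mul a b ha hb => intro ξ; rw [map_mul, Module.End.mul_apply, ha, hb, mul_assoc]
    | add a b ha hb =>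
      intro ξ
      rw [map_add, LinearMap.add_apply, map_add, LinearMap.add_apply, ha, hb, add_mul]
  rw [key, hc, Algebra.smul_def, Algebra.commutes]
end
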